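/- For every τ ∈ ℍ, the function F(τ,ρ) = −(w^{1/2}/θ₄(τ)) ∑_{n∈ℤ} (−1)ⁿ q^{n²/2 − 1/8}/(1 − w q^{n−1/2}), w = e^{2πiρ}, is meromorphic in ρ ∈ ℂ with simple poles exactly at the points ρ ∈ ℤ + (ℤ + 1/2)τ, and Res_{ρ=τ/2} F(τ,ρ) = q^{1/8}/(2πi θ₄(τ)). Moreover F(τ,ρ) is regular at ρ = 1/2 and ρ = (1+τ)/2, with F(τ,1/2) = 0 and F(τ,(1+τ)/2) = q^{1/8}/(2i). -/

import Mathlib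

open Complex

noncomputable section

/-- `e^{2πiτs}`, i.e. `q^s` for `q = e^{2πiτ}`. -/
def qp (τ s : ℂ) : ℂ := Complex.exp (2 * (Real.pi : ℂ) * Complex.I * τ * s)

/-- Jacobi theta function `θ₂(τ,v) = ∑_{r∈ℤ+1/2} q^{r²/2} e^{2πirv}`. -/
def theta2e (τ v : ℂ) : ℂ :=
  ∑' n : ℤ, qp τ (((n : ℂ) + 1 / 2) ^ 2 / 2) *
    Complex.exp (2 * (Real.pi : ℂ) * Complex.I * ((n : ℂ) + 1 / 2) * v)

/-- Jacobi theta function `θ₃(τ,v) = ∑_{n∈ℤ} q^{n²/2} e^{2πinv}`. -/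
def theta3e (τ v : ℂ) : ℂ :=
  ∑' n : ℤ, qp τ ((n : ℂ) ^ 2 / 2) *
    Complex.exp (2 * (Real.pi : ℂ) * Complex.I * (n : ℂ) * v)

/-- Jacobi theta function `θ₄(τ,v) = ∑_{n∈ℤ} (−1)ⁿ q^{n²/2} e^{2πinv}`. -/
def theta4e (τ v : ℂ) : ℂ :=
  ∑' n : ℤ, (-1 : ℂ) ^ n * qp τ ((n : ℂ) ^ 2 / 2) *
    Complex.exp (2 * (Real.pi : ℂ) * Complex.I * (n : ℂ) * v)

/-- Theta constant `θ₂(τ) = θ₂(τ,0)`. -/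
def theta2 (τ : ℂ) : ℂ := theta2e τ 0

/-- Theta constant `θ₃(τ) = θ₃(τ,0)`. -/
def theta3 (τ : ℂ) : ℂ := theta3e τ 0

/-- Theta constant `θ₄(τ) = θ₄(τ,0)`. -/
def theta4 (τ : ℂ) : ℂ := theta4e τ 0

/-- The mock Jacobi form
`F(τ,ρ) = −(w^{1/2}/θ₄(τ)) ∑_{n∈ℤ} (−1)ⁿ q^{n²/2−1/8}/(1 − w q^{n−1/2})`, `w = e^{2πiρ}`. -/
def Fe (τ ρ : ℂ) : ℂ :=
  -(Complex.exp ((Real.pi : ℂ) * Complex.I * ρ) / theta4 τ) *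
    ∑' n : ℤ, (-1 : ℂ) ^ n * qp τ ((n : ℂ) ^ 2 / 2 - 1 / 8) /
      (1 - Complex.exp (2 * (Real.pi : ℂ) * Complex.I * ρ) * qp τ ((n : ℂ) - 1 / 2))

open Filter Topology

lemma th_four_eq (τ : ℂ) : theta4 τ = jacobiTheta (τ + 1) := by
  rw [theta4, theta4e, jacobiTheta]
  refine tsum_congr fun n => ?_
  have h1 : (-1 : ℂ) ^ n = Complex.exp ((Real.pi : ℂ) * I * (n : ℂ) ^ 2) := by
    have : ((-1 : ℂ)) ^ n = (-1 : ℂ) ^ (n ^ 2) := by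
      rcases Int.even_or_odd n with h | h
      · rw [h.neg_one_zpow, (h.pow_of_ne_zero two_ne_zero).neg_one_zpow]
      · rw [h.neg_one_zpow, (h.pow).neg_one_zpow]
    rw [this, ← Complex.exp_pi_mul_I, ← Complex.exp_int_mul]
    congr 1; push_cast; ring
  rw [h1, qp, ← Complex.exp_add, ← Complex.exp_add]
  congr 1; ring

lemma th_summ (τ : ℂ) (hτ : 0 < τ.im) :
    Summable (fun n : ℤ => Complex.exp (Real.pi * I * (n : ℂ) ^ 2 * τ)) := by
  have := (summable_jacobiTheta₂_term_iff 0 τ).2 hτ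
  refine this.congr fun n => ?_
  rw [jacobiTheta₂_term]; congr 1; ring

lemma th_summ_sign (τ : ℂ) (hτ : 0 < τ.im) :
    Summable (fun n : ℤ => (-1 : ℂ) ^ n * Complex.exp (Real.pi * I * (n : ℂ) ^ 2 * τ)) := by
  refine Summable.of_norm ?_
  refine (th_summ τ hτ).norm.congr fun n => ?_
  rw [norm_mul, norm_zpow]; simp

lemma th_four_eq_sum (τ : ℂ) :
    theta4 τ = ∑' n : ℤ, (-1 : ℂ) ^ n * Complex.exp (Real.pi * I * (n : ℂ) ^ 2 * τ) := by
  rw [theta4, theta4e]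
  refine tsum_congr fun n => ?_
  rw [qp, mul_assoc, ← Complex.exp_add]
  congr 2; ring

lemma th_double (τ : ℂ) (hτ : 0 < τ.im) :
    jacobiTheta τ * theta4 τ = theta4 (2 * τ) ^ 2 := by
  have hτ2 : 0 < (2 * τ).im := by simp [hτ]
  set e : ℂ → ℂ := fun x => Complex.exp (Real.pi * I * x * τ) with he
  have heA : ∀ x y, e x * e y = e (x + y) := by
    intro x y; simp only [he]; rw [← Complex.exp_add]; congr 1; ring
  have s1 : Summable (fun n : ℤ => ‖e ((n : ℂ) ^ 2)‖) := (th_summ τ hτ).norm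
  have s2 : Summable (fun n : ℤ => ‖(-1 : ℂ) ^ n * e ((n : ℂ) ^ 2)‖) := (th_summ_sign τ hτ).norm
  have s3 : Summable (fun n : ℤ => ‖(-1 : ℂ) ^ n * e (2 * (n : ℂ) ^ 2)‖) := by
    refine (th_summ_sign (2 * τ) hτ2).norm.congr fun n => ?_
    simp only [he]; congr 3; ring
  have P1 : jacobiTheta τ * theta4 τ
      = ∑' p : ℤ × ℤ, e ((p.1 : ℂ) ^ 2) * ((-1 : ℂ) ^ p.2 * e ((p.2 : ℂ) ^ 2)) := by
    rw [th_four_eq_sum, jacobiTheta, tsum_mul_tsum_of_summable_norm s1 s2]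
  have P1' : jacobiTheta τ * theta4 τ
      = ∑' p : ℤ × ℤ, ((-1 : ℂ) ^ p.1 * e ((p.1 : ℂ) ^ 2)) * e ((p.2 : ℂ) ^ 2) := by
    rw [mul_comm, th_four_eq_sum, jacobiTheta, tsum_mul_tsum_of_summable_norm s2 s1]
  have P2 : theta4 (2 * τ) ^ 2 = ∑' p : ℤ × ℤ, ((-1 : ℂ) ^ p.1 * e (2 * (p.1 : ℂ) ^ 2)) *
      ((-1 : ℂ) ^ p.2 * e (2 * (p.2 : ℂ) ^ 2)) := by
    have : theta4 (2 * τ) = ∑' n : ℤ, (-1 : ℂ) ^ n * e (2 * (n : ℂ) ^ 2) := by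
      rw [th_four_eq_sum]
      refine tsum_congr fun n => ?_
      simp only [he]; congr 2; ring
    rw [sq, this, tsum_mul_tsum_of_summable_norm s3 s3]
  have S1 := summable_mul_of_summable_norm s1 s2
  have S1' := summable_mul_of_summable_norm s2 s1
  have key : 2 * (jacobiTheta τ * theta4 τ) = 2 * theta4 (2 * τ) ^ 2 := by
    rw [two_mul]
    nth_rewrite 1 [P1]
    rw [P1', ← S1.tsum_add S1', P2, ← tsum_mul_left]
    have hinj : Function.Injective (fun p : ℤ × ℤ => (p.1 + p.2, p.1 - p.2)) := by
      rintro ⟨a, b⟩ ⟨c, d⟩ h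
      simp only [Prod.mk.injEq] at h ⊢
      omega
    rw [← hinj.tsum_eq]
    · refine tsum_congr fun p => ?_
      obtain ⟨a, b⟩ := p
      simp only
      have h1 : (-1 : ℂ) ^ (a - b) = (-1 : ℂ) ^ a * (-1 : ℂ) ^ b := by
        rw [zpow_sub₀ (by norm_num)]
        rcases Int.even_or_odd b with h | h <;> simp [h.neg_one_zpow, div_neg]
      have h2 : (-1 : ℂ) ^ (a + b) = (-1 : ℂ) ^ a * (-1 : ℂ) ^ b := zpow_add₀ (by norm_num) _ _
      have h3 : e (((a + b : ℤ) : ℂ) ^ 2) * e (((a - b : ℤ) : ℂ) ^ 2)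
          = e (2 * (a : ℂ) ^ 2) * e (2 * (b : ℂ) ^ 2) := by
        rw [heA, heA]; congr 1; push_cast; ring
      rw [h1, h2]
      linear_combination 2 * ((-1 : ℂ) ^ a * (-1 : ℂ) ^ b) * h3
    · rintro ⟨m, n⟩ hmn
      have hpar : Even (m + n) := by
        by_contra hodd
        apply hmn
        have h0 : (-1 : ℂ) ^ m + (-1 : ℂ) ^ n = 0 := by
          rcases Int.even_or_odd m with h | h <;> rcases Int.even_or_odd n with h' | h'
          · exact absurd (h.add h') hodd
          · simp [h.neg_one_zpow, h'.neg_one_zpow]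
          · simp [h.neg_one_zpow, h'.neg_one_zpow]
          · exact absurd (h.add_odd h') hodd
        simp only
        linear_combination (e ((m : ℂ) ^ 2) * e ((n : ℂ) ^ 2)) * h0
      obtain ⟨k, hk⟩ := hpar
      refine ⟨(k, m - k), ?_⟩
      simp only [Prod.mk.injEq]
      omega
  exact mul_left_cancel₀ two_ne_zero key

lemma th_four_ne_zero (τ : ℂ) (hτ : 0 < τ.im) : theta4 τ ≠ 0 := by
  intro h0
  have hall : ∀ k : ℕ, theta4 (2 ^ k * τ) = 0 := by
    intro k
    induction k with
    | zero => simpa using h0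
    | succ k ih =>
      have him : 0 < ((2 : ℂ) ^ k * τ).im := by
        have : ((2 : ℂ) ^ k * τ) = (((2 : ℝ) ^ k : ℝ) : ℂ) * τ := by push_cast; rfl
        rw [this, im_ofReal_mul]; positivity
      have := th_double _ him
      rw [ih, mul_zero] at this
      rw [pow_succ, mul_comm ((2 : ℂ) ^ k), mul_assoc]
      exact pow_eq_zero_iff (two_ne_zero) |>.1 this.symm
  have himk : ∀ k : ℕ, ((2 : ℂ) ^ k * τ + 1).im = 2 ^ k * τ.im := by
    intro k
    have : ((2 : ℂ) ^ k * τ) = (((2 : ℝ) ^ k : ℝ) : ℂ) * τ := by push_cast; rfl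
    rw [add_im, this, im_ofReal_mul]; simp
  have hbd : ∀ k : ℕ, (1 : ℝ) ≤ 2 / (1 - Real.exp (-Real.pi * (2 ^ k * τ.im)))
      * Real.exp (-Real.pi * (2 ^ k * τ.im)) := by
    intro k
    have h := norm_jacobiTheta_sub_one_le (τ := (2 : ℂ) ^ k * τ + 1)
      (by rw [himk]; positivity)
    rw [← th_four_eq, hall, himk] at h
    simpa using h
  have ht : Tendsto (fun k : ℕ => Real.exp (-Real.pi * (2 ^ k * τ.im))) atTop (𝓝 0) := by
    apply Real.tendsto_exp_atBot.comp
    have h1 : Tendsto (fun k : ℕ => (2 : ℝ) ^ k * τ.im) atTop atTop :=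
      (tendsto_pow_atTop_atTop_of_one_lt (by norm_num)).atTop_mul_const hτ
    exact h1.const_mul_atTop_of_neg (by linarith [Real.pi_pos])
  have ht2 : Tendsto (fun k : ℕ => 2 / (1 - Real.exp (-Real.pi * (2 ^ k * τ.im)))
      * Real.exp (-Real.pi * (2 ^ k * τ.im))) atTop (𝓝 (2 / (1 - 0) * 0)) :=
    (tendsto_const_nhds.div (tendsto_const_nhds.sub ht) (by norm_num)).mul ht
  have := ge_of_tendsto' ht2 hbd
  norm_num at this

def cco (τ : ℂ) (n : ℤ) : ℂ := (-1 : ℂ) ^ n * qp τ ((n : ℂ) ^ 2 / 2 - 1 / 8)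

def dde (τ : ℂ) (n : ℤ) (ρ : ℂ) : ℂ :=
  1 - Complex.exp (2 * (Real.pi : ℂ) * Complex.I * ρ) * qp τ ((n : ℂ) - 1 / 2)

lemma Fe_eq (τ ρ : ℂ) : Fe τ ρ = -(Complex.exp ((Real.pi : ℂ) * Complex.I * ρ) / theta4 τ) *
    ∑' n : ℤ, cco τ n / dde τ n ρ := rfl

lemma cco_ne (τ : ℂ) (n : ℤ) : cco τ n ≠ 0 :=
  mul_ne_zero (zpow_ne_zero _ (by norm_num)) (Complex.exp_ne_zero _)

lemma cco_eq (τ : ℂ) (n : ℤ) : cco τ n =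
    qp τ (-1 / 8) * ((-1 : ℂ) ^ n * Complex.exp (Real.pi * I * (n : ℂ) ^ 2 * τ)) := by
  rw [cco, qp, qp, mul_left_comm, ← Complex.exp_add]
  congr 2; ring

lemma cco_summ (τ : ℂ) (hτ : 0 < τ.im) : Summable (fun n => ‖cco τ n‖) := by
  have := ((th_summ_sign τ hτ).mul_left (qp τ (-1 / 8))).norm
  exact this.congr fun n => by rw [cco_eq]

lemma dde_eq (τ : ℂ) (n : ℤ) (ρ : ℂ) :
    dde τ n ρ = 1 - Complex.exp (2 * (Real.pi : ℂ) * I * (ρ + ((n : ℂ) - 1 / 2) * τ)) := by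
  rw [dde, qp, ← Complex.exp_add]; congr 2; ring

lemma dde_zero_iff (τ : ℂ) (n : ℤ) (ρ : ℂ) :
    dde τ n ρ = 0 ↔ ∃ m : ℤ, ρ = (m : ℂ) + (1 / 2 - (n : ℂ)) * τ := by
  rw [dde_eq, sub_eq_zero, eq_comm, Complex.exp_eq_one_iff]
  have hp : (2 * (Real.pi : ℂ) * I) ≠ 0 := Complex.two_pi_I_ne_zero
  refine exists_congr fun m => ?_
  rw [mul_comm (m : ℂ), mul_right_inj' hp]
  constructor <;> intro h <;> linear_combination h

lemma norm_e (τ ρ : ℂ) (n : ℤ) :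
    ‖Complex.exp (2 * (Real.pi : ℂ) * I * (ρ + ((n : ℂ) - 1 / 2) * τ))‖
      = Real.exp (-(2 * Real.pi) * (ρ.im + ((n : ℝ) - 1 / 2) * τ.im)) := by
  rw [Complex.norm_exp]
  congr 1
  have : (2 * (Real.pi : ℂ) * I * (ρ + ((n : ℂ) - 1 / 2) * τ))
     = ((2 * Real.pi : ℝ) : ℂ) * ((ρ + (((n : ℝ) - 1 / 2 : ℝ) : ℂ) * τ) * I) := by
    push_cast; ring
  rw [this, re_ofReal_mul, mul_I_re, add_im, im_ofReal_mul]; ring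

lemma dde_lower (τ : ℂ) (hτ : 0 < τ.im) (ρ : ℂ) :
    ∃ δ > 0, ∀ n, dde τ n ρ = 0 ∨ δ ≤ ‖dde τ n ρ‖ := by
  have ev : ∀ᶠ n : ℤ in cofinite, (1 / 2 : ℝ) ≤ ‖dde τ n ρ‖ := by
    rw [Int.cofinite_eq, eventually_sup]
    constructor
    · have t : Tendsto (fun n : ℤ => Real.exp (-(2 * Real.pi) * (ρ.im + ((n : ℝ) - 1 / 2) * τ.im)))
          atBot atTop := by
        apply Real.tendsto_exp_atTop.comp
        refine Tendsto.const_mul_atBot_of_neg (by linarith [Real.pi_pos]) ?_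
        refine tendsto_atBot_add_const_left _ _ (Tendsto.atBot_mul_const hτ ?_)
        exact tendsto_atBot_add_const_right _ _ (tendsto_intCast_atBot_iff.2 tendsto_id)
      filter_upwards [t.eventually_ge_atTop 2] with n hn
      rw [← norm_e] at hn
      rw [dde_eq, norm_sub_rev]
      have := norm_sub_norm_le (Complex.exp (2 * (Real.pi : ℂ) * I * (ρ + ((n : ℂ) - 1 / 2) * τ))) 1
      rw [norm_one] at this
      linarith
    · have t : Tendsto (fun n : ℤ => Real.exp (-(2 * Real.pi) * (ρ.im + ((n : ℝ) - 1 / 2) * τ.im)))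
          atTop (𝓝 0) := by
        apply Real.tendsto_exp_atBot.comp
        refine Tendsto.const_mul_atTop_of_neg (by linarith [Real.pi_pos]) ?_
        refine tendsto_atTop_add_const_left _ _ (Tendsto.atTop_mul_const hτ ?_)
        exact tendsto_atTop_add_const_right _ _ tendsto_intCast_atTop_atTop
      filter_upwards [t.eventually_le_const (u := 1 / 2) (by norm_num)] with n hn
      rw [← norm_e] at hn
      rw [dde_eq]
      have := norm_sub_norm_le 1 (Complex.exp (2 * (Real.pi : ℂ) * I * (ρ + ((n : ℂ) - 1 / 2) * τ)))
      rw [norm_one] at this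
      linarith
  have hfin : {n : ℤ | ¬ (1 / 2 : ℝ) ≤ ‖dde τ n ρ‖}.Finite := ev
  have : ∀ s : Finset ℤ, ∃ δ > 0, ∀ n ∈ s, dde τ n ρ = 0 ∨ δ ≤ ‖dde τ n ρ‖ := by
    intro s
    induction s using Finset.induction_on with
    | empty => exact ⟨1, one_pos, by simp⟩
    | insert a s _ ih =>
      obtain ⟨δ, hδ, h⟩ := ih
      by_cases ha : dde τ a ρ = 0
      · refine ⟨δ, hδ, fun n hn => ?_⟩
        rcases Finset.mem_insert.1 hn with rfl | hn
        · exact Or.inl ha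
        · exact h n hn
      · refine ⟨min δ ‖dde τ a ρ‖, lt_min hδ (norm_pos_iff.2 ha), fun n hn => ?_⟩
        rcases Finset.mem_insert.1 hn with rfl | hn
        · exact Or.inr (min_le_right _ _)
        · exact (h n hn).imp id fun h => (min_le_left _ _).trans h
  obtain ⟨δ, hδ, h⟩ := this hfin.toFinset
  refine ⟨min δ (1 / 2), lt_min hδ (by norm_num), fun n => ?_⟩
  by_cases hn : (1 / 2 : ℝ) ≤ ‖dde τ n ρ‖
  · exact Or.inr ((min_le_right _ _).trans hn)
  · exact (h n (by simpa using hn)).imp id fun h => (min_le_left _ _).trans h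

lemma term_summ (τ : ℂ) (hτ : 0 < τ.im) (ρ : ℂ) : Summable (fun n => cco τ n / dde τ n ρ) := by
  obtain ⟨δ, hδ, h⟩ := dde_lower τ hτ ρ
  refine Summable.of_norm_bounded ((cco_summ τ hτ).div_const δ) fun n => ?_
  rcases h n with h | h
  · rw [h]; simp only [div_zero, norm_zero]; positivity
  · rw [norm_div]; gcongr

lemma part_analytic (τ : ℂ) (hτ : 0 < τ.im) (ρ : ℂ) (S : Set ℤ) (hS : ∀ n ∈ S, dde τ n ρ ≠ 0) :
    AnalyticAt ℂ (fun z => ∑' n, S.indicator (fun n => cco τ n / dde τ n z) n) ρ := by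
  obtain ⟨δ, hδ, h⟩ := dde_lower τ hτ ρ
  let v : ℂ → ℂ := fun z => Complex.exp (-(2 * (Real.pi : ℂ) * I * (z - ρ)))
  have hv : Continuous v := by fun_prop
  have hv1 : v ρ = 1 := by simp [v]
  let U : Set ℂ := {z | ‖v z - 1‖ < δ / 2} ∩ {z | ‖v z‖ < 2}
  have hU : IsOpen U := (isOpen_lt (by fun_prop) continuous_const).inter
    (isOpen_lt (by fun_prop) continuous_const)
  have hρU : ρ ∈ U := by
    refine ⟨?_, ?_⟩ <;> simp [hv1, hδ]
  have hbd : ∀ n ∈ S, ∀ z ∈ U, δ / 4 ≤ ‖dde τ n z‖ := by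
    intro n hn z hz
    have hd : δ ≤ ‖dde τ n ρ‖ := (h n).resolve_left (hS n hn)
    have e1 : v z * dde τ n z = (v z - 1) + dde τ n ρ := by
      have : v z * Complex.exp (2 * (Real.pi : ℂ) * I * z)
          = Complex.exp (2 * (Real.pi : ℂ) * I * ρ) := by
        simp only [v]; rw [← Complex.exp_add]; congr 1; ring
      rw [dde, dde]
      linear_combination (-qp τ ((n : ℂ) - 1 / 2)) * this
    have e2 : ‖dde τ n ρ‖ - ‖v z - 1‖ ≤ ‖v z‖ * ‖dde τ n z‖ := by
      rw [← norm_mul, e1]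
      have := norm_sub_le (v z - 1 + dde τ n ρ) (v z - 1)
      rw [add_sub_cancel_left] at this
      linarith
    have h1 : ‖v z - 1‖ < δ / 2 := hz.1
    have h2 : ‖v z‖ < 2 := hz.2
    have h3 : ‖v z‖ * ‖dde τ n z‖ ≤ 2 * ‖dde τ n z‖ := by gcongr
    linarith
  have hdiff : DifferentiableOn ℂ
      (fun z => ∑' n, S.indicator (fun n => cco τ n / dde τ n z) n) U := by
    refine differentiableOn_tsum_of_summable_norm (u := fun n => ‖cco τ n‖ / (δ / 4))
      ((cco_summ τ hτ).div_const _) ?_ hU ?_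
    · intro n
      by_cases hn : n ∈ S
      · simp only [Set.indicator_of_mem hn]
        refine DifferentiableOn.div (differentiableOn_const _) ?_ ?_
        · unfold dde; fun_prop
        · intro z hz h0
          have := hbd n hn z hz
          rw [h0, norm_zero] at this; linarith
      · simp only [Set.indicator_of_notMem hn]; exact differentiableOn_const _
    · intro n z hz
      by_cases hn : n ∈ S
      · simp only [Set.indicator_of_mem hn]
        rw [norm_div]
        have := hbd n hn z hz
        gcongr
      · simp only [Set.indicator_of_notMem hn, norm_zero]; positivity
  exact hdiff.analyticAt (hU.mem_nhds hρU)

lemma Fe_analytic (τ : ℂ) (hτ : 0 < τ.im) (ρ : ℂ)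
    (hρ : ¬ ∃ m n : ℤ, ρ = (m : ℂ) + ((n : ℂ) + 1 / 2) * τ) :
    AnalyticAt ℂ (fun z => Fe τ z) ρ := by
  have h := part_analytic τ hτ ρ Set.univ (fun n _ h0 => hρ (by
    obtain ⟨m, hm⟩ := (dde_zero_iff τ n ρ).1 h0
    exact ⟨m, -n, by rw [hm]; push_cast; ring⟩))
  simp only [Set.indicator_univ] at h
  simp only [Fe_eq]
  refine AnalyticAt.mul ?_ h
  have : Differentiable ℂ
    (fun z => -(Complex.exp ((Real.pi : ℂ) * Complex.I * z) / theta4 τ)) := by fun_prop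
  exact this.analyticAt ρ

lemma Fe_res (τ : ℂ) (hτ : 0 < τ.im) (m k : ℤ) (p : ℂ)
    (hp : p = (m : ℂ) + (1 / 2 - (k : ℂ)) * τ) :
    Tendsto (fun ρ => (ρ - p) * Fe τ ρ) (𝓝[≠] p)
      (𝓝 (Complex.exp ((Real.pi : ℂ) * I * p) * cco τ k / (2 * (Real.pi : ℂ) * I * theta4 τ))) := by
  have hpi : (2 * (Real.pi : ℂ) * I) ≠ 0 := Complex.two_pi_I_ne_zero
  have hne : ∀ n ∈ ({k} : Set ℤ)ᶜ, dde τ n p ≠ 0 := by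
    intro n hn h0
    obtain ⟨m', hm'⟩ := (dde_zero_iff τ n p).1 h0
    apply hn
    have h1 : ((m - m' : ℝ) : ℂ) + (((n : ℝ) - k : ℝ) : ℂ) * τ = 0 := by
      push_cast; linear_combination hm' - hp
    have h2 := congrArg Complex.im h1
    rw [add_im, im_ofReal_mul, ofReal_im, zero_add, zero_im] at h2
    have h3 : (n : ℝ) - k = 0 := (mul_eq_zero.1 h2).resolve_right hτ.ne'
    have : (n : ℝ) = k := by linarith
    exact_mod_cast this
  have hR := part_analytic τ hτ p _ hne
  set R := fun z => ∑' n, (({k} : Set ℤ)ᶜ).indicator (fun n => cco τ n / dde τ n z) n with hRdef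
  have hsplit : ∀ z, ∑' n : ℤ, cco τ n / dde τ n z = cco τ k / dde τ k z + R z := by
    intro z
    rw [(term_summ τ hτ z).tsum_eq_add_tsum_ite k]
    congr 1
    refine tsum_congr fun n => ?_
    by_cases hn : n = k <;> simp [hn, Set.indicator]
  have hd0 : dde τ k p = 0 := (dde_zero_iff τ k p).2 ⟨m, hp⟩
  have hder : HasDerivAt (dde τ k) (-(2 * (Real.pi : ℂ) * I)) p := by
    have h1 : HasDerivAt (fun z => Complex.exp (2 * (Real.pi : ℂ) * I * z))
        (Complex.exp (2 * (Real.pi : ℂ) * I * p) * (2 * (Real.pi : ℂ) * I)) p := by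
      simpa using ((hasDerivAt_id p).const_mul (2 * (Real.pi : ℂ) * I)).cexp
    have h2 := (h1.mul_const (qp τ ((k : ℂ) - 1 / 2))).const_sub 1
    refine h2.congr_deriv ?_
    have h3 : Complex.exp (2 * (Real.pi : ℂ) * I * p) * qp τ ((k : ℂ) - 1 / 2) = 1 := by
      rw [dde] at hd0; linear_combination -hd0
    linear_combination (-(2 * (Real.pi : ℂ) * I)) * h3
  have hs := hasDerivAt_iff_tendsto_slope.1 hder
  have hs2 : Tendsto (fun z => (z - p) / dde τ k z) (𝓝[≠] p) (𝓝 (-(2 * (Real.pi : ℂ) * I))⁻¹) := by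
    refine (hs.inv₀ (neg_ne_zero.2 hpi)).congr fun z => ?_
    rw [slope_def_field, hd0, sub_zero, inv_div]
  have hR' : Tendsto R (𝓝[≠] p) (𝓝 (R p)) := hR.continuousAt.tendsto.mono_left nhdsWithin_le_nhds
  have hz : Tendsto (fun z => z - p) (𝓝[≠] p) (𝓝 (p - p)) :=
    ((continuous_id.sub continuous_const).tendsto p).mono_left nhdsWithin_le_nhds
  have hE : Tendsto (fun z => -(Complex.exp ((Real.pi : ℂ) * I * z) / theta4 τ)) (𝓝[≠] p)
      (𝓝 (-(Complex.exp ((Real.pi : ℂ) * I * p) / theta4 τ))) := by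
    have : Continuous (fun z => -(Complex.exp ((Real.pi : ℂ) * I * z) / theta4 τ)) := by fun_prop
    exact (this.tendsto p).mono_left nhdsWithin_le_nhds
  have hfin := hE.mul ((hs2.const_mul (cco τ k)).add (hz.mul hR'))
  have hval : -(Complex.exp ((Real.pi : ℂ) * I * p) / theta4 τ) *
      (cco τ k * (-(2 * (Real.pi : ℂ) * I))⁻¹ + (p - p) * R p)
      = Complex.exp ((Real.pi : ℂ) * I * p) * cco τ k / (2 * (Real.pi : ℂ) * I * theta4 τ) := by
    have := th_four_ne_zero τ hτ
    rw [inv_neg, sub_self]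
    field_simp
    ring
  rw [hval] at hfin
  refine hfin.congr fun z => ?_
  rw [Fe_eq, hsplit]; ring

lemma qp_add (τ a b : ℂ) : qp τ (a + b) = qp τ a * qp τ b := by
  rw [qp, qp, qp, ← Complex.exp_add]; congr 1; ring

lemma neg_one_sub (n : ℤ) : (-1 : ℂ) ^ (1 - n) = -(-1 : ℂ) ^ n := by
  rw [zpow_sub₀ (by norm_num)]
  rcases Int.even_or_odd n with h | h <;> simp [h.neg_one_zpow]

lemma Fe_half (τ : ℂ) (hτ : 0 < τ.im) : Fe τ (1 / 2) = 0 := by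
  rw [Fe_eq]
  have hd : ∀ n, dde τ n (1 / 2) = 1 + qp τ ((n : ℂ) - 1 / 2) := by
    intro n
    rw [dde, show (2 * (Real.pi : ℂ) * I * (1 / 2)) = Real.pi * I by ring, Complex.exp_pi_mul_I]
    ring
  have hn0 : ∀ n, dde τ n (1 / 2) ≠ 0 := by
    intro n h0
    obtain ⟨m, hm⟩ := (dde_zero_iff _ _ _).1 h0
    have h1 : ((1 / 2 - m : ℝ) : ℂ) = ((1 / 2 - n : ℝ) : ℂ) * τ := by
      push_cast; linear_combination hm
    have h2 := congrArg Complex.im h1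
    rw [im_ofReal_mul, ofReal_im] at h2
    have h3 : (1 / 2 : ℝ) - n = 0 := (mul_eq_zero.1 h2.symm).resolve_right hτ.ne'
    have h4 : (1 : ℝ) = 2 * n := by linarith
    have h5 : (1 : ℤ) = 2 * n := by exact_mod_cast h4
    omega
  have hsym : ∀ n : ℤ, cco τ (1 - n) / dde τ (1 - n) (1 / 2) = -(cco τ n / dde τ n (1 / 2)) := by
    intro n
    rw [← neg_div, div_eq_div_iff (hn0 _) (hn0 _), hd, hd, cco, cco, neg_one_sub]
    have e1 : qp τ (((1 - n : ℤ) : ℂ) ^ 2 / 2 - 1 / 8)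
        = qp τ ((n : ℂ) ^ 2 / 2 - 1 / 8) * qp τ (((1 - n : ℤ) : ℂ) - 1 / 2) := by
      rw [← qp_add]; congr 1; push_cast; ring
    have e2 : qp τ (((1 - n : ℤ) : ℂ) - 1 / 2) * qp τ ((n : ℂ) - 1 / 2) = 1 := by
      rw [← qp_add, qp]
      refine Eq.trans (congrArg Complex.exp ?_) Complex.exp_zero
      push_cast; ring
    rw [e1]
    linear_combination (-(-1 : ℂ) ^ n * qp τ ((n : ℂ) ^ 2 / 2 - 1 / 8)) * e2
  have h1 : ∑' n : ℤ, cco τ n / dde τ n (1 / 2) = -∑' n : ℤ, cco τ n / dde τ n (1 / 2) := by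
    conv_lhs => rw [← (Equiv.subLeft (1 : ℤ)).tsum_eq]
    rw [← tsum_neg]
    exact tsum_congr fun n => hsym n
  rw [self_eq_neg.1 h1, mul_zero]

lemma Fe_half' (τ : ℂ) (hτ : 0 < τ.im) :
    Fe τ ((1 + τ) / 2) = qp τ (1 / 8) / (2 * I) := by
  rw [Fe_eq]
  set r := (1 + τ) / 2 with hr
  have hd : ∀ n : ℤ, dde τ n r = 1 + qp τ n := by
    intro n
    rw [dde_eq, show (2 * (Real.pi : ℂ) * I * (r + ((n : ℂ) - 1 / 2) * τ))
      = Real.pi * I + 2 * Real.pi * I * τ * n by rw [hr]; ring, Complex.exp_add,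
      Complex.exp_pi_mul_I, qp]
    ring
  have hn0 : ∀ n, dde τ n r ≠ 0 := by
    intro n h0
    obtain ⟨m, hm⟩ := (dde_zero_iff _ _ _).1 h0
    have h1 : ((1 / 2 - m : ℝ) : ℂ) = ((- n : ℝ) : ℂ) * τ := by
      rw [hr] at hm
      push_cast; linear_combination hm
    have h2 := congrArg Complex.im h1
    rw [im_ofReal_mul, ofReal_im] at h2
    have h3 : (- n : ℝ) = 0 := (mul_eq_zero.1 h2.symm).resolve_right hτ.ne'
    rw [h3] at h1
    have h4 : (1 / 2 - m : ℝ) = 0 := by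
      rw [ofReal_zero, zero_mul] at h1; exact_mod_cast h1
    have h4 : (1 : ℝ) = 2 * m := by linarith
    have h5 : (1 : ℤ) = 2 * m := by exact_mod_cast h4
    omega
  have hsym : ∀ n : ℤ, cco τ n / dde τ n r + cco τ (-n) / dde τ (-n) r = cco τ n := by
    intro n
    have ec : cco τ (-n) = cco τ n := by
      rw [cco, cco]; congr 1
      · rcases Int.even_or_odd n with h | h <;> simp [h.neg_one_zpow, zpow_neg]
      · push_cast; rw [neg_sq]
    have e2 : qp τ ((-n : ℤ) : ℂ) * qp τ (n : ℂ) = 1 := by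
      rw [← qp_add, qp]
      refine Eq.trans (congrArg Complex.exp ?_) Complex.exp_zero
      push_cast; ring
    rw [ec, div_add_div _ _ (hn0 _) (hn0 _), div_eq_iff (mul_ne_zero (hn0 _) (hn0 _)), hd, hd]
    linear_combination (-cco τ n) * e2
  have hs := term_summ τ hτ r
  have hs' : Summable (fun n : ℤ => cco τ (-n) / dde τ (-n) r) :=
    (Equiv.neg ℤ).summable_iff.2 hs
  have h1 : 2 * ∑' n : ℤ, cco τ n / dde τ n r = qp τ (-1 / 8) * theta4 τ := by
    have : ∑' n : ℤ, cco τ (-n) / dde τ (-n) r = ∑' n : ℤ, cco τ n / dde τ n r :=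
      (Equiv.neg ℤ).tsum_eq (fun n => cco τ n / dde τ n r)
    rw [two_mul]
    nth_rewrite 2 [← this]
    rw [← hs.tsum_add hs', th_four_eq_sum, ← tsum_mul_left]
    exact tsum_congr fun n => by rw [hsym, cco_eq]
  have h2 : Complex.exp (Real.pi * I * r) = I * qp τ (1 / 4) := by
    rw [show (Real.pi * I * r) = Real.pi / 2 * I + 2 * Real.pi * I * τ * (1 / 4) by rw [hr]; ring,
      Complex.exp_add, Complex.exp_pi_div_two_mul_I, qp]
  have h3 : qp τ (1 / 8) = qp τ (1 / 4) * qp τ (-1 / 8) := by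
    rw [← qp_add]; norm_num
  have h4 : ∑' n : ℤ, cco τ n / dde τ n r = qp τ (-1 / 8) * theta4 τ / 2 := by
    rw [← h1]; ring
  have := th_four_ne_zero τ hτ
  rw [h4, h2, h3]
  field_simp
  rw [I_sq]; ring

/-- Pole structure of `F(τ,·)`: it is analytic away from `ρ ∈ ℤ + (ℤ+1/2)τ`, it has a
simple pole at each such point, `Res_{ρ=τ/2} F = q^{1/8}/(2πiθ₄(τ))`, and `F` is regular
at `ρ = 1/2` and `ρ = (1+τ)/2` with `F(τ,1/2) = 0` and `F(τ,(1+τ)/2) = q^{1/8}/(2i)`. -/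
theorem F_pole_structure (τ : ℂ) (hτ : 0 < τ.im) :
    (∀ ρ : ℂ, (¬ ∃ m n : ℤ, ρ = (m : ℂ) + ((n : ℂ) + 1 / 2) * τ) →
      AnalyticAt ℂ (fun z => Fe τ z) ρ) ∧
    (∀ m n : ℤ, ∃ c : ℂ, c ≠ 0 ∧
      Tendsto (fun ρ => (ρ - ((m : ℂ) + ((n : ℂ) + 1 / 2) * τ)) * Fe τ ρ)
        (𝓝[≠] ((m : ℂ) + ((n : ℂ) + 1 / 2) * τ)) (𝓝 c)) ∧
    Tendsto (fun ρ => (ρ - τ / 2) * Fe τ ρ) (𝓝[≠] (τ / 2))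
      (𝓝 (qp τ (1 / 8) / (2 * (Real.pi : ℂ) * Complex.I * theta4 τ))) ∧
    Fe τ (1 / 2) = 0 ∧
    Fe τ ((1 + τ) / 2) = qp τ (1 / 8) / (2 * Complex.I) := by
  have h4 := th_four_ne_zero τ hτ
  have hpi : (2 * (Real.pi : ℂ) * I) ≠ 0 := Complex.two_pi_I_ne_zero
  refine ⟨fun ρ hρ => Fe_analytic τ hτ ρ hρ, fun m n => ?_, ?_, Fe_half τ hτ, Fe_half' τ hτ⟩
  · refine ⟨_, ?_, Fe_res τ hτ m (-n) _ (by push_cast; ring)⟩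
    exact div_ne_zero (mul_ne_zero (Complex.exp_ne_zero _) (cco_ne _ _)) (mul_ne_zero hpi h4)
  · have h := Fe_res τ hτ 0 0 (τ / 2) (by push_cast; ring)
    have e : Complex.exp ((Real.pi : ℂ) * I * (τ / 2)) * cco τ 0 = qp τ (1 / 8) := by
      rw [cco, qp, qp, zpow_zero, one_mul, ← Complex.exp_add]
      congr 1; push_cast; ring
    rwa [e] at h
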